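/- arXiv:2109.01865 — 2 statements merged into one kernel-verified Lean document; each statement's English description precedes it below -/
import Mathlib

section
/- Let v_0 = v_0⊥ + v_0^L ∈ S∖L with v_0⊥ ∈ L⊥∖{0}, v_0^L ∈ L, and let {v_k} be generated by the iteration v_{k+1} = (v_k − α_k g_k)/‖v_k − α_k g_k‖, where α_k > 0 and g_k = ∇E(p(v_k)) satisfies (g_k, u) = 0 for all u ∈ [L, v_k]. Writing v_k = v_k⊥ + v_k^L with v_k⊥ ∈ L⊥ and v_k^L ∈ L, then for all k: ‖v_0⊥‖ ≤ ‖v_k⊥‖ ≤ 1, and v_k^L = τ_k v_0^L for scalars satisfying 0 < τ_{k+1} ≤ τ_k ≤ 1. In particular, all v_k lie in V_0. -/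
open Filter Topology Set
open scoped RealInnerProductSpace ENNReal

noncomputable section

/-- The half subspace `[L, v] = {t • v + w : t ≥ 0, w ∈ L}`. -/
def halfspaceCone {X : Type*} [NormedAddCommGroup X] [InnerProductSpace ℝ X]
    (L : Submodule ℝ X) (v : X) : Set X :=
  {y | ∃ t : ℝ, 0 ≤ t ∧ ∃ w ∈ (L : Set X), y = t • v + w}

/-- The normalized gradient-step map `v(α) = (v - α g)/‖v - α g‖`. -/
def stepv {X : Type*} [NormedAddCommGroup X] [InnerProductSpace ℝ X] (v g : X) (α : ℝ) : X :=
  ‖v - α • g‖⁻¹ • (v - α • g)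

/-- The set `V₀ = {v = v⊥ + τ v₀^L ∈ S : v⊥ ∈ L⊥, 0 ≤ τ ≤ 1}`. -/
def V0 {X : Type*} [NormedAddCommGroup X] [InnerProductSpace ℝ X]
    (L : Submodule ℝ X) (v0L : X) : Set X :=
  {v | ‖v‖ = 1 ∧ ∃ w ∈ (Lᗮ : Set X), ∃ τ : ℝ, 0 ≤ τ ∧ τ ≤ 1 ∧ v = w + τ • v0L}

lemma self_mem_halfspaceCone {X : Type*} [NormedAddCommGroup X] [InnerProductSpace ℝ X]
    (L : Submodule ℝ X) (v : X) : v ∈ halfspaceCone L v :=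
  ⟨1, zero_le_one, 0, L.zero_mem, by simp⟩

lemma subset_halfspaceCone {X : Type*} [NormedAddCommGroup X] [InnerProductSpace ℝ X]
    (L : Submodule ℝ X) (v : X) : (L : Set X) ⊆ halfspaceCone L v :=
  fun w hw => ⟨0, le_rfl, w, hw, by simp⟩

lemma norm_add_sq_of_mem_orthogonal {X : Type*} [NormedAddCommGroup X] [InnerProductSpace ℝ X]
    {L : Submodule ℝ X} {x y : X} (hx : x ∈ Lᗮ) (hy : y ∈ L) :
    ‖x + y‖ ^ 2 = ‖x‖ ^ 2 + ‖y‖ ^ 2 := by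
  rw [norm_add_sq_real, Submodule.inner_left_of_mem_orthogonal hy hx, mul_zero, add_zero]

lemma one_le_norm_sub_smul {X : Type*} [NormedAddCommGroup X] [InnerProductSpace ℝ X]
    {v g : X} (hv : ‖v‖ = 1) (hgv : ⟪g, v⟫ = 0) (a : ℝ) : 1 ≤ ‖v - a • g‖ := by
  refine le_of_pow_le_pow_left₀ two_ne_zero (norm_nonneg _) ?_
  rw [norm_sub_sq_real, inner_smul_right, real_inner_comm, hgv, hv]
  linarith [sq_nonneg ‖a • g‖]

lemma norm_stepv {X : Type*} [NormedAddCommGroup X] [InnerProductSpace ℝ X]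
    {v g : X} (hv : ‖v‖ = 1) (hgv : ⟪g, v⟫ = 0) (a : ℝ) : ‖stepv v g a‖ = 1 := by
  have hpos : 0 < ‖v - a • g‖ := zero_lt_one.trans_le (one_le_norm_sub_smul hv hgv a)
  rw [stepv, norm_smul, norm_inv, norm_norm, inv_mul_cancel₀ hpos.ne']

/-- Lemma 2.8: along the LMM iteration
`v_{k+1} = (v_k − α_k g_k)/‖v_k − α_k g_k‖` with `g_k ⟂ [L, v_k]`, the orthogonal
decompositions `v_k = v_k⊥ + τ_k v₀^L` satisfy `‖v₀⊥‖ ≤ ‖v_k⊥‖ ≤ 1` and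
`0 < τ_{k+1} ≤ τ_k ≤ 1`; in particular all `v_k` lie in `V₀`. -/
theorem statement6
    {X : Type*} [NormedAddCommGroup X] [InnerProductSpace ℝ X] [CompleteSpace X]
    (E : X → ℝ) (hE : ContDiff ℝ 1 E)
    (L : Submodule ℝ X) [FiniteDimensional ℝ L]
    (v0perp v0L : X) (hv0perp : v0perp ∈ Lᗮ) (hv0perp0 : v0perp ≠ 0) (hv0L : v0L ∈ L)
    (hv0norm : ‖v0perp + v0L‖ = 1)
    (p : X → X)
    (v : ℕ → X) (α : ℕ → ℝ) (g : ℕ → X)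
    (hα : ∀ k, 0 < α k)
    (hgdef : ∀ k, g k = gradient E (p (v k)))
    (hgorth : ∀ k, ∀ u ∈ halfspaceCone L (v k), ⟪g k, u⟫ = 0)
    (hv00 : v 0 = v0perp + v0L)
    (hrec : ∀ k, v (k + 1) = stepv (v k) (g k) (α k)) :
    ∃ (vperp : ℕ → X) (τ : ℕ → ℝ),
      (∀ k, v k = vperp k + τ k • v0L ∧ vperp k ∈ Lᗮ ∧
        ‖v0perp‖ ≤ ‖vperp k‖ ∧ ‖vperp k‖ ≤ 1 ∧
        0 < τ k ∧ τ k ≤ 1 ∧ v k ∈ V0 L v0L) ∧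
      ∀ k, τ (k + 1) ≤ τ k := by
  have hgv : ∀ k, ⟪g k, v k⟫ = 0 := fun k => hgorth k _ (self_mem_halfspaceCone L (v k))
  have hgL : ∀ k, g k ∈ Lᗮ := fun k =>
    (Submodule.mem_orthogonal' L (g k)).2 fun u hu =>
      hgorth k u (subset_halfspaceCone L (v k) hu)
  have hvnorm : ∀ k, ‖v k‖ = 1 := by
    intro k
    induction k with
    | zero => rw [hv00, hv0norm]
    | succ k ih => rw [hrec]; exact norm_stepv ih (hgv k) (α k)
  have hge : ∀ k, 1 ≤ ‖v k - α k • g k‖ := fun k =>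
    one_le_norm_sub_smul (hvnorm k) (hgv k) (α k)
  have hcpos : ∀ k, 0 < ‖v k - α k • g k‖⁻¹ := fun k =>
    inv_pos.2 (zero_lt_one.trans_le (hge k))
  have hcle : ∀ k, ‖v k - α k • g k‖⁻¹ ≤ 1 := fun k => inv_le_one_of_one_le₀ (hge k)
  let τ : ℕ → ℝ := fun k => ∏ i ∈ Finset.range k, ‖v i - α i • g i‖⁻¹
  have hτsucc : ∀ k, τ (k + 1) = τ k * ‖v k - α k • g k‖⁻¹ := fun k =>
    Finset.prod_range_succ _ k
  have hτpos : ∀ k, 0 < τ k := fun k => Finset.prod_pos fun i _ => hcpos i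
  have hτle : ∀ k, τ k ≤ 1 := fun k =>
    Finset.prod_le_one (fun i _ => (hcpos i).le) fun i _ => hcle i
  have hperp : ∀ k, v k - τ k • v0L ∈ Lᗮ := by
    intro k
    induction k with
    | zero => simpa [τ, hv00] using hv0perp
    | succ k ih =>
      have hstep : v (k + 1) - τ (k + 1) • v0L =
          ‖v k - α k • g k‖⁻¹ • ((v k - τ k • v0L) - α k • g k) := by
        rw [hrec, hτsucc, stepv]
        module
      rw [hstep]
      exact Lᗮ.smul_mem _ (Lᗮ.sub_mem ih (Lᗮ.smul_mem _ (hgL k)))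
  have hdecomp : ∀ k, v k = (v k - τ k • v0L) + τ k • v0L := fun k =>
    (sub_add_cancel _ _).symm
  have hsq0 : 1 = ‖v0perp‖ ^ 2 + ‖v0L‖ ^ 2 := by
    rw [← norm_add_sq_of_mem_orthogonal hv0perp hv0L, hv0norm, one_pow]
  have hsq : ∀ k, 1 = ‖v k - τ k • v0L‖ ^ 2 + τ k ^ 2 * ‖v0L‖ ^ 2 := by
    intro k
    have h := norm_add_sq_of_mem_orthogonal (hperp k) (L.smul_mem (τ k) hv0L)
    rwa [← hdecomp, hvnorm, norm_smul, mul_pow, Real.norm_eq_abs, sq_abs, one_pow] at h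
  refine ⟨fun k => v k - τ k • v0L, τ, fun k => ⟨hdecomp k, hperp k, ?_, ?_, hτpos k, hτle k,
    hvnorm k, _, hperp k, τ k, (hτpos k).le, hτle k, hdecomp k⟩, fun k => ?_⟩
  · refine le_of_pow_le_pow_left₀ two_ne_zero (norm_nonneg _) ?_
    have hτsq : τ k ^ 2 * ‖v0L‖ ^ 2 ≤ ‖v0L‖ ^ 2 :=
      mul_le_of_le_one_left (sq_nonneg _) (pow_le_one₀ (hτpos k).le (hτle k))
    linarith [hsq k]
  · refine le_of_pow_le_pow_left₀ two_ne_zero zero_le_one ?_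
    have hnonneg : 0 ≤ τ k ^ 2 * ‖v0L‖ ^ 2 := by positivity
    linarith [hsq k]
  · rw [hτsucc]
    exact mul_le_of_le_one_right (hτpos k).le (hcle k)
end
end

section
/- Suppose E ∈ C¹(X,ℝ), let p be a peak selection of E with respect to L, and let {v_k} ⊆ V_0 and {w_k = p(v_k)} be sequences generated by the normalized ZH-type nonmonotone LMM (Algorithm 2), with E_k = E(w_k), g_k = ∇E(w_k), step-sizes α_k and weights Q_k as in the algorithm. Assume (i) p is continuous on V_0, (ii) t_k ≥ δ for some δ > 0 and all k, and (iii) inf_{k≥0} E_k > −∞. Then: (a) ∑_{k=0}^∞ α_k ‖g_k‖²/Q_{k+1} < ∞; and (b) if {w_k} converges to some point ū ∈ X, then ū ∉ L and E'(ū) = 0, i.e., ū is a critical point of E not belonging to L. -/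
open Filter Topology Set
open scoped RealInnerProductSpace ENNReal

noncomputable section

section

variable {X : Type*} [NormedAddCommGroup X] [InnerProductSpace ℝ X]

lemma one_le_norm_sub_smul_s13 {v g : X} (hv : ‖v‖ = 1) (hvg : ⟪v, g⟫ = 0) (β : ℝ) :
    1 ≤ ‖v - β • g‖ := by
  have h : ‖v - β • g‖ * ‖v - β • g‖ = ‖v‖ * ‖v‖ + ‖β • g‖ * ‖β • g‖ :=
    norm_sub_sq_eq_norm_sq_add_norm_sq_real (by rw [inner_smul_right, hvg, mul_zero])
  rw [hv] at h
  nlinarith [norm_nonneg (v - β • g), mul_self_nonneg ‖β • g‖]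

lemma stepv_zero {v : X} (hv : ‖v‖ = 1) (g : X) : stepv v g 0 = v := by
  simp [stepv, hv]

lemma stepv_mem_V0 {L : Submodule ℝ X} {v0L v g : X} (hv : v ∈ V0 L v0L) (hg : g ∈ Lᗮ)
    (hvg : ⟪v, g⟫ = 0) (β : ℝ) : stepv v g β ∈ V0 L v0L := by
  obtain ⟨hv1, w, hw, τ, hτ0, hτ1, hvw⟩ := hv
  have hN := one_le_norm_sub_smul_s13 hv1 hvg β
  have hN0 : 0 < ‖v - β • g‖ := by linarith
  refine ⟨?_, ‖v - β • g‖⁻¹ • (w - β • g), ?_, ‖v - β • g‖⁻¹ * τ, by positivity, ?_, ?_⟩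
  · rw [stepv, norm_smul, norm_inv, norm_norm, inv_mul_cancel₀ hN0.ne']
  · exact Lᗮ.smul_mem _ (Lᗮ.sub_mem hw (Lᗮ.smul_mem _ hg))
  · exact mul_le_one₀ (inv_le_one_of_one_le₀ hN) hτ0 hτ1
  · rw [stepv]
    generalize ‖v - β • g‖ = N
    rw [hvw]
    module

lemma starProjection_orthogonal_ne_zero_of_mem_V0 {L : Submodule ℝ X} [FiniteDimensional ℝ L]
    {v0L u : X} (hv0L : ‖v0L‖ < 1) (hu : u ∈ V0 L v0L) (hL : v0L ∈ L) :
    Lᗮ.starProjection u ≠ 0 := by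
  obtain ⟨hu1, w, hw, τ, hτ0, hτ1, rfl⟩ := hu
  intro h
  have h1 : Lᗮ.starProjection (w + τ • v0L) = w := by
    rw [map_add, Submodule.starProjection_eq_self_iff.2 hw,
      (Submodule.starProjection_apply_eq_zero_iff _).2
        (Submodule.le_orthogonal_orthogonal L (L.smul_mem τ hL)), add_zero]
  rw [h] at h1
  rw [← h1, zero_add, norm_smul, Real.norm_of_nonneg hτ0] at hu1
  nlinarith [norm_nonneg v0L]

lemma inner_gradient_eq_zero_of_isLocalMaxOn [CompleteSpace X] {E : X → ℝ} {s : Set X} {x d : X}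
    (hE : DifferentiableAt ℝ E x) (hmax : IsLocalMaxOn E s x)
    (hd : ∀ᶠ r : ℝ in 𝓝 0, x + r • d ∈ s) : ⟪gradient E x, d⟫ = 0 := by
  have hline : HasDerivAt (fun r : ℝ => x + r • d) d 0 := by
    simpa using ((hasDerivAt_id (0 : ℝ)).smul_const d).const_add x
  have hcomp : HasDerivAt (fun r : ℝ => E (x + r • d)) (fderiv ℝ E x d) 0 := by
    have hE' : HasFDerivAt E (fderiv ℝ E x) (x + (0 : ℝ) • d) := by
      simpa using hE.hasFDerivAt
    exact hE'.comp_hasDerivAt (0 : ℝ) hline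
  have htend : Tendsto (fun r : ℝ => x + r • d) (𝓝 0) (𝓝[s] x) := by
    refine tendsto_nhdsWithin_iff.2 ⟨?_, hd⟩
    simpa using hline.continuousAt.tendsto
  have hloc : IsLocalMax (fun r : ℝ => E (x + r • d)) 0 := by
    filter_upwards [htend.eventually hmax] with r hr
    simpa using hr
  have := hloc.hasDerivAt_eq_zero hcomp
  rw [gradient, InnerProductSpace.toDual_symm_apply, this]

/-- The standing properties of a peak selection `p` relative to `L`, written as
`p u = t u • u + wL u` on the unit sphere. -/
structure IsPeakSelection (E : X → ℝ) (L : Submodule ℝ X) (p : X → X) (t : X → ℝ)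
    (wL : X → X) : Prop where
  isLocalMaxOn : ∀ u : X, ‖u‖ = 1 → IsLocalMaxOn E (halfspaceCone L u) (p u)
  decomp : ∀ u : X, ‖u‖ = 1 → p u = t u • u + wL u ∧ 0 ≤ t u ∧ wL u ∈ L

namespace IsPeakSelection

variable {E : X → ℝ} {L : Submodule ℝ X} {p wL : X → X} {t : X → ℝ}

lemma gradient_mem_orthogonal [CompleteSpace X] (hp : IsPeakSelection E L p t wL)
    (hE : Differentiable ℝ E) {u : X} (hu : ‖u‖ = 1) : gradient E (p u) ∈ Lᗮ := by
  rw [Submodule.mem_orthogonal']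
  intro d hd
  obtain ⟨h1, h2, h3⟩ := hp.decomp u hu
  refine inner_gradient_eq_zero_of_isLocalMaxOn (hE _) (hp.isLocalMaxOn u hu) ?_
  refine Eventually.of_forall fun r => ⟨t u, h2, wL u + r • d, L.add_mem h3 (L.smul_mem r hd), ?_⟩
  rw [h1, add_assoc]

lemma inner_gradient_self [CompleteSpace X] (hp : IsPeakSelection E L p t wL)
    (hE : Differentiable ℝ E) {u : X} (hu : ‖u‖ = 1) (ht : 0 < t u) :
    ⟪u, gradient E (p u)⟫ = 0 := by
  rw [real_inner_comm]
  obtain ⟨h1, h2, h3⟩ := hp.decomp u hu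
  refine inner_gradient_eq_zero_of_isLocalMaxOn (hE _) (hp.isLocalMaxOn u hu) ?_
  filter_upwards [lt_mem_nhds (neg_lt_zero.2 ht)] with r hr
  refine ⟨t u + r, by linarith, wL u, h3, ?_⟩
  rw [h1]
  module

lemma starProjection_eq [FiniteDimensional ℝ L] (hp : IsPeakSelection E L p t wL)
    {u : X} (hu : ‖u‖ = 1) :
    Lᗮ.starProjection (p u) = t u • Lᗮ.starProjection u := by
  obtain ⟨h1, h2, h3⟩ := hp.decomp u hu
  rw [h1, map_add, map_smul, (Submodule.starProjection_apply_eq_zero_iff _).2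
        (Submodule.le_orthogonal_orthogonal L h3), add_zero]

lemma continuousOn_coeff [FiniteDimensional ℝ L] (hp : IsPeakSelection E L p t wL) {v0L : X}
    (hL : v0L ∈ L) (hv0L : ‖v0L‖ < 1) (hpc : ContinuousOn p (V0 L v0L)) :
    ContinuousOn t (V0 L v0L) := by
  have hc : ContinuousOn (fun u => ‖Lᗮ.starProjection (p u)‖ / ‖Lᗮ.starProjection u‖)
      (V0 L v0L) := by
    refine ContinuousOn.div (Lᗮ.starProjection.continuous.comp_continuousOn hpc).norm
      Lᗮ.starProjection.continuous.norm.continuousOn fun u hu => ?_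
    exact norm_ne_zero_iff.2 (starProjection_orthogonal_ne_zero_of_mem_V0 hv0L hu hL)
  refine hc.congr fun u hu => ?_
  have h0 := norm_ne_zero_iff.2 (starProjection_orthogonal_ne_zero_of_mem_V0 hv0L hu hL)
  simp only
  rw [hp.starProjection_eq hu.1, norm_smul, Real.norm_of_nonneg (hp.decomp u hu.1).2.1,
    mul_div_cancel_right₀ _ h0]

/-- If along the path `β ↦ stepv v g β` the first-order decrease rate of `E ∘ p` exceeds `c`,
then `E ∘ p` decreases at least linearly with slope `c`. Since each `p u` is only a local
maximizer, the comparison is made infinitesimally at every point of the path. -/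
lemma energy_stepv_le [CompleteSpace X] (hp : IsPeakSelection E L p t wL)
    (hE : ContDiff ℝ 1 E) {v0L : X} (hpc : ContinuousOn p (V0 L v0L))
    (htc : ContinuousOn t (V0 L v0L)) {v g : X} (hv : v ∈ V0 L v0L) (hg : g ∈ Lᗮ)
    (hvg : ⟪v, g⟫ = 0) {b c : ℝ} (hb : 0 ≤ b)
    (hrate : ∀ β ∈ Ico 0 b,
      c < t (stepv v g β) / ‖v - β • g‖ * ⟪gradient E (p (stepv v g β)), g⟫) :
    E (p (stepv v g b)) ≤ E (p v) - c * b := by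
  have hN : ∀ β : ℝ, 0 < ‖v - β • g‖ := fun β =>
    zero_lt_one.trans_le (one_le_norm_sub_smul_s13 hv.1 hvg β)
  have hmem : ∀ β : ℝ, stepv v g β ∈ V0 L v0L := stepv_mem_V0 hv hg hvg
  have hNc : Continuous fun β : ℝ => ‖v - β • g‖ := by fun_prop
  have huc : Continuous fun β : ℝ => stepv v g β := by
    unfold stepv
    exact (hNc.inv₀ fun β => (hN β).ne').smul (by fun_prop)
  have hpuc : Continuous fun β : ℝ => p (stepv v g β) :=
    hpc.comp_continuous huc hmem
  have htuc : Continuous fun β : ℝ => t (stepv v g β) :=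
    htc.comp_continuous huc hmem
  set f : ℝ → ℝ := fun β => E (p (stepv v g β)) with hf
  have hfc : Continuous f := hE.continuous.comp hpuc
  set f' : ℝ → ℝ := fun β =>
    -(t (stepv v g β) / ‖v - β • g‖ * ⟪gradient E (p (stepv v g β)), g⟫) with hf'
  have hslope : ∀ x ∈ Ico (0 : ℝ) b, ∀ r, f' x < r → ∃ᶠ z in 𝓝[>] x, slope f x z < r := by
    intro x hx r hr
    refine Eventually.frequently ?_
    -- `y z` lies in the cone at `stepv v g x` and differs from `p (stepv v g z)` along `g`.
    set s : ℝ → ℝ := fun z => t (stepv v g z) * (z - x) / ‖v - z • g‖ with hs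
    have hsc : Continuous s :=
      (htuc.mul (by fun_prop)).div hNc fun z => (hN z).ne'
    set y : ℝ → X := fun z => p (stepv v g z) + s z • g with hy
    have hyc : Continuous y := hpuc.add (hsc.smul continuous_const)
    have hyx : y x = p (stepv v g x) := by simp [hy, hs]
    have hycone : ∀ z, y z ∈ halfspaceCone L (stepv v g x) := by
      intro z
      obtain ⟨h1, h2, h3⟩ := hp.decomp _ (hmem z).1
      refine ⟨t (stepv v g z) / ‖v - z • g‖ * ‖v - x • g‖,
        mul_nonneg (div_nonneg h2 (hN z).le) (hN x).le, wL (stepv v g z), h3, ?_⟩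
      have e : ‖v - x • g‖ • stepv v g x = v - x • g := by
        rw [stepv, smul_inv_smul₀ (hN x).ne']
      rw [hy, mul_smul, e]
      simp only
      rw [h1, hs]
      simp only
      generalize t (stepv v g z) = T
      rw [stepv]
      generalize ‖v - z • g‖ = N
      module
    have hle : ∀ᶠ z in 𝓝 x, E (y z) ≤ E (p (stepv v g x)) := by
      have : Tendsto y (𝓝 x) (𝓝[halfspaceCone L (stepv v g x)] (p (stepv v g x))) :=
        tendsto_nhdsWithin_iff.2 ⟨hyx ▸ hyc.tendsto x, Eventually.of_forall hycone⟩
      exact this.eventually (hp.isLocalMaxOn _ (hmem x).1)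
    have hstrict : HasStrictFDerivAt E (fderiv ℝ E (p (stepv v g x))) (p (stepv v g x)) :=
      hE.contDiffAt.hasStrictFDerivAt one_ne_zero
    have hlim : Tendsto (fun z => (z - x)⁻¹ • (E (p (stepv v g z)) - E (y z))) (𝓝[>] x)
        (𝓝 (f' x)) := by
      have hdiff : ∀ z, p (stepv v g z) - y z =
          (z - x) • -((t (stepv v g z) / ‖v - z • g‖) • g) := fun z => by
        simp only [hy, hs]
        module
      have hkc : Continuous fun z => t (stepv v g z) / ‖v - z • g‖ :=
        htuc.div hNc fun z => (hN z).ne'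
      have hbig : (fun z => p (stepv v g z) - y z) =O[𝓝[>] x] fun z => z - x := by
        simp_rw [hdiff]
        have h1 : (fun z => -((t (stepv v g z) / ‖v - z • g‖) • g)) =O[𝓝[>] x]
            fun _ => (1 : ℝ) :=
          ((hkc.smul continuous_const).neg.tendsto x |>.mono_left
            nhdsWithin_le_nhds).isBigO_one ℝ
        simpa using (Asymptotics.isBigO_refl (fun z : ℝ => z - x) (𝓝[>] x)).smul h1
      have hpair : Tendsto (fun z => (p (stepv v g z), y z)) (𝓝[>] x)
          (𝓝 (p (stepv v g x), p (stepv v g x))) := by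
        have := (hpuc.prodMk hyc).tendsto x
        rw [hyx] at this
        exact this.mono_left nhdsWithin_le_nhds
      have hrem := ((hstrict.isLittleO.comp_tendsto hpair).trans_isBigO hbig).tendsto_div_nhds_zero
      have hmain : Tendsto
          (fun z => -(t (stepv v g z) / ‖v - z • g‖ * fderiv ℝ E (p (stepv v g x)) g))
          (𝓝[>] x) (𝓝 (f' x)) := by
        have := (hkc.mul_const (fderiv ℝ E (p (stepv v g x)) g)).neg.tendsto x
        simp only [hf', gradient, InnerProductSpace.toDual_symm_apply]
        exact this.mono_left nhdsWithin_le_nhds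
      refine (zero_add (f' x) ▸ hrem.add hmain).congr' ?_
      filter_upwards [self_mem_nhdsWithin] with z hz
      have hz0 : z - x ≠ 0 := (sub_pos.2 hz).ne'
      simp only [Function.comp_apply, hdiff, map_smul, map_neg, smul_eq_mul]
      field_simp
      ring
    filter_upwards [hlim.eventually (gt_mem_nhds hr), nhdsWithin_le_nhds hle,
      self_mem_nhdsWithin] with z hz1 hz2 hz3
    refine lt_of_le_of_lt ?_ hz1
    rw [slope_def_field, smul_eq_mul, div_eq_inv_mul]
    have : 0 < z - x := sub_pos.2 hz3
    gcongr
  have hB : ∀ x, HasDerivAt (fun β => E (p v) - c * β) (-c) x := fun x => by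
    simpa using ((hasDerivAt_id x).const_mul c).const_sub (E (p v))
  refine image_le_of_liminf_slope_right_lt_deriv_boundary' (f := f) (f' := f')
    hfc.continuousOn hslope (B := fun β => E (p v) - c * β) (B' := fun _ => -c) ?_ ?_
    (fun x _ => (hB x).hasDerivWithinAt) ?_ (right_mem_Icc.2 hb)
  · simp [hf, stepv_zero hv.1]
  · exact fun x _ => (hB x).continuousAt.continuousWithinAt
  · intro x hx _
    exact neg_lt_neg (hrate x hx)

/-- Uniform sufficient decrease near a point of `V0` whose peak is not critical. -/
lemma eventually_energy_stepv_le [CompleteSpace X] (hp : IsPeakSelection E L p t wL)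
    (hE : ContDiff ℝ 1 E) {v0L : X} (hpc : ContinuousOn p (V0 L v0L))
    (htc : ContinuousOn t (V0 L v0L)) {u : X} (hu : u ∈ V0 L v0L) (htu : 0 < t u)
    (hgu : gradient E (p u) ≠ 0) {σ : ℝ} (hσ : σ < 1) :
    ∃ r > 0, ∀ᶠ v in 𝓝[V0 L v0L] u, ∀ b, 0 ≤ b → b < r →
      E (p (stepv v (gradient E (p v)) b)) ≤
        E (p v) - σ * b * t v * ‖gradient E (p v)‖ ^ 2 := by
  have hEd : Differentiable ℝ E := hE.differentiable one_ne_zero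
  have hgc : Continuous (gradient E) :=
    (InnerProductSpace.toDual ℝ X).symm.continuous.comp (hE.continuous_fderiv one_ne_zero)
  have hvmem : ∀ᶠ v in 𝓝[V0 L v0L] u, v ∈ V0 L v0L ∧ 0 < t v :=
    (eventually_mem_nhdsWithin).and ((htc u hu).eventually (lt_mem_nhds htu))
  have hpt : Tendsto p (𝓝[V0 L v0L] u) (𝓝 (p u)) := hpc u hu
  have htt : Tendsto t (𝓝[V0 L v0L] u) (𝓝 (t u)) := htc u hu
  have hgt : Tendsto (fun v => gradient E (p v)) (𝓝[V0 L v0L] u) (𝓝 (gradient E (p u))) :=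
    (hgc.tendsto _).comp hpt
  set F : Filter (X × ℝ) := 𝓝[V0 L v0L] u ×ˢ 𝓝 0 with hF
  have h1 : Tendsto (fun q : X × ℝ => q.1) F (𝓝 u) :=
    tendsto_fst.mono_right nhdsWithin_le_nhds
  have hgF : Tendsto (fun q : X × ℝ => gradient E (p q.1)) F (𝓝 (gradient E (p u))) :=
    hgt.comp tendsto_fst
  have hdir : Tendsto (fun q : X × ℝ => q.1 - q.2 • gradient E (p q.1)) F (𝓝 u) := by
    simpa using h1.sub (tendsto_snd.smul hgF)
  have hnorm : Tendsto (fun q : X × ℝ => ‖q.1 - q.2 • gradient E (p q.1)‖) F (𝓝 1) := by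
    simpa [hu.1] using hdir.norm
  have hstep : Tendsto (fun q : X × ℝ => stepv q.1 (gradient E (p q.1)) q.2) F
      (𝓝[V0 L v0L] u) := by
    refine tendsto_nhdsWithin_iff.2 ⟨?_, ?_⟩
    · simpa [stepv] using (hnorm.inv₀ one_ne_zero).smul hdir
    · filter_upwards [tendsto_fst.eventually hvmem] with q hq
      exact stepv_mem_V0 hq.1 (hp.gradient_mem_orthogonal hEd hq.1.1)
        (hp.inner_gradient_self hEd hq.1.1 hq.2) _
  have hlhs := (((htt.comp tendsto_fst).const_mul σ).mul (hgF.norm.pow 2))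
  have hrhs := ((htt.comp hstep).div hnorm one_ne_zero).mul ((hgt.comp hstep).inner (𝕜 := ℝ) hgF)
  have hlt : σ * t u * ‖gradient E (p u)‖ ^ 2 <
      t u / 1 * ⟪gradient E (p u), gradient E (p u)⟫ := by
    rw [real_inner_self_eq_norm_sq, div_one]
    have : 0 < t u * ‖gradient E (p u)‖ ^ 2 := by positivity
    nlinarith
  obtain ⟨P, hP, R, hR, hPR⟩ := eventually_prod_iff.1 (hlhs.eventually_lt hrhs hlt)
  obtain ⟨r, hr, hrR⟩ := Metric.eventually_nhds_iff.1 hR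
  refine ⟨r, hr, ?_⟩
  filter_upwards [hP, hvmem] with v hv hv' b hb hbr
  have := hp.energy_stepv_le hE hpc htc hv'.1 (hp.gradient_mem_orthogonal hEd hv'.1.1)
    (hp.inner_gradient_self hEd hv'.1.1 hv'.2) hb
    (c := σ * t v * ‖gradient E (p v)‖ ^ 2) fun β hβ => hPR hv (hrR (by
      rw [Real.dist_eq, sub_zero, abs_of_nonneg hβ.1]
      exact hβ.2.trans hbr))
  linarith

/-- If `p (v k)` converges along a sequence in `V0` whose coefficients `t` stay away from zero,
then a subsequence of `v` converges in `V0`. -/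
lemma exists_tendsto_subseq [FiniteDimensional ℝ L] (hp : IsPeakSelection E L p t wL) {v0L : X}
    (hL : v0L ∈ L) (hv0L : ‖v0L‖ < 1) {v : ℕ → X} (hv : ∀ k, v k ∈ V0 L v0L)
    {δ : ℝ} (hδ : 0 < δ) (ht : ∀ k, δ ≤ t (v k)) {x : X}
    (hx : Tendsto (fun k => p (v k)) atTop (𝓝 x)) :
    ∃ u ∈ V0 L v0L, ∃ φ : ℕ → ℕ, StrictMono φ ∧ Tendsto (v ∘ φ) atTop (𝓝 u) := by
  choose hv1 w hw τ hτ0 hτ1 hvw using hv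
  obtain ⟨τ', hτ', φ, hφ, hlim⟩ := isCompact_Icc.tendsto_subseq fun k => ⟨hτ0 k, hτ1 k⟩
  have hPv : ∀ k, Lᗮ.starProjection (v k) = w k := fun k => by
    rw [hvw k, map_add, Submodule.starProjection_eq_self_iff.2 (hw k),
      (Submodule.starProjection_apply_eq_zero_iff _).2
        (Submodule.le_orthogonal_orthogonal L (L.smul_mem _ hL)), add_zero]
  have hwn : ∀ k, ‖w k‖ = √(1 - (τ k * ‖v0L‖) ^ 2) := fun k => by
    have h := norm_add_sq_eq_norm_sq_add_norm_sq_real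
      (show ⟪w k, τ k • v0L⟫ = 0 from
        (Submodule.mem_orthogonal' L _).1 (hw k) _ (L.smul_mem _ hL))
    rw [← hvw k, hv1 k, norm_smul, Real.norm_of_nonneg (hτ0 k)] at h
    rw [← Real.sqrt_sq (norm_nonneg (w k))]
    congr 1
    linarith
  have hn' : 0 < √(1 - (τ' * ‖v0L‖) ^ 2) := by
    refine Real.sqrt_pos.2 ?_
    have h0 : 0 ≤ τ' * ‖v0L‖ := mul_nonneg hτ'.1 (norm_nonneg _)
    have h1 : τ' * ‖v0L‖ < 1 := by nlinarith [hτ'.2, norm_nonneg v0L]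
    nlinarith
  have hwlim : Tendsto (fun j => ‖w (φ j)‖) atTop (𝓝 (√(1 - (τ' * ‖v0L‖) ^ 2))) := by
    simp_rw [hwn]
    exact (((hlim.mul_const _).pow 2).const_sub 1).sqrt
  have htw : Tendsto (fun j => t (v (φ j)) • w (φ j)) atTop (𝓝 (Lᗮ.starProjection x)) := by
    have := (Lᗮ.starProjection.continuous.tendsto x).comp (hx.comp hφ.tendsto_atTop)
    refine this.congr fun j => ?_
    rw [← hPv, ← hp.starProjection_eq (hv1 _)]
    rfl
  have htlim : Tendsto (fun j => t (v (φ j))) atTop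
      (𝓝 (‖Lᗮ.starProjection x‖ / √(1 - (τ' * ‖v0L‖) ^ 2))) := by
    refine (htw.norm.div hwlim hn'.ne').congr' ?_
    filter_upwards [hwlim.eventually (lt_mem_nhds hn')] with j hj
    simp only [Pi.div_apply]
    rw [norm_smul, Real.norm_of_nonneg (hδ.le.trans (ht _)), mul_div_cancel_right₀ _ hj.ne']
  have ht' := ge_of_tendsto' htlim fun j => ht _
  have hwl := (htlim.inv₀ (hδ.trans_le ht').ne').smul htw
  have hvl : Tendsto (v ∘ φ) atTop
      (𝓝 ((‖Lᗮ.starProjection x‖ / √(1 - (τ' * ‖v0L‖) ^ 2))⁻¹ • Lᗮ.starProjection x +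
        τ' • v0L)) := by
    refine (hwl.add (hlim.smul_const v0L)).congr fun j => ?_
    simp only [Function.comp_apply]
    rw [inv_smul_smul₀ (hδ.trans_le (ht _)).ne', ← hvw]
  refine ⟨_, ⟨?_, _, ?_, τ', hτ'.1, hτ'.2, rfl⟩, φ, hφ, hvl⟩
  · refine tendsto_nhds_unique hvl.norm ?_
    simp [hv1]
  · exact Lᗮ.smul_mem _ (Submodule.starProjection_apply_mem _ _)

end IsPeakSelection

end

/-! ### The nonmonotone reference values -/

section

variable {η Q C e d : ℕ → ℝ}

lemma one_le_weight (hη : ∀ k, 0 ≤ η k) (hQ0 : Q 0 = 1) (hQ : ∀ k, Q (k + 1) = η k * Q k + 1)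
    (k : ℕ) : 1 ≤ Q k := by
  induction k with
  | zero => exact hQ0.ge
  | succ k ih => nlinarith [hQ k, hη k]

lemma weight_le (hη : ∀ k, 0 ≤ η k) (hη1 : ∀ k, η k ≤ 1) (hQ0 : Q 0 = 1)
    (hQ : ∀ k, Q (k + 1) = η k * Q k + 1) (k : ℕ) : Q k ≤ k + 1 := by
  induction k with
  | zero => simp [hQ0]
  | succ k ih =>
    push_cast
    nlinarith [hQ k, hη1 k, one_le_weight hη hQ0 hQ k]

lemma energy_le_reference (hη : ∀ k, 0 ≤ η k) (hQ0 : Q 0 = 1)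
    (hQ : ∀ k, Q (k + 1) = η k * Q k + 1) (hC0 : C 0 = e 0)
    (hC : ∀ k, C (k + 1) = (η k * Q k * C k + e (k + 1)) / Q (k + 1))
    (hd : ∀ k, 0 ≤ d k) (he : ∀ k, e (k + 1) ≤ C k - d k) (k : ℕ) : e k ≤ C k := by
  cases k with
  | zero => exact hC0.ge
  | succ k =>
    have hQk := one_le_weight hη hQ0 hQ k
    have hQk1 := one_le_weight hη hQ0 hQ (k + 1)
    rw [hC, le_div_iff₀ (by linarith), hQ]
    have : 0 ≤ η k * Q k := mul_nonneg (hη k) (by linarith)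
    nlinarith [he k, hd k]

lemma summable_decrease_div_weight (hη : ∀ k, 0 ≤ η k) (hQ0 : Q 0 = 1)
    (hQ : ∀ k, Q (k + 1) = η k * Q k + 1) (hC0 : C 0 = e 0)
    (hC : ∀ k, C (k + 1) = (η k * Q k * C k + e (k + 1)) / Q (k + 1))
    (hd : ∀ k, 0 ≤ d k) (he : ∀ k, e (k + 1) ≤ C k - d k) (hbdd : BddBelow (range e)) :
    Summable fun k => d k / Q (k + 1) := by
  obtain ⟨B, hB⟩ := hbdd
  have hQpos : ∀ k, 0 < Q k := fun k => zero_lt_one.trans_le (one_le_weight hη hQ0 hQ k)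
  have hstep : ∀ k, d k / Q (k + 1) ≤ C k - C (k + 1) := fun k => by
    rw [div_le_iff₀ (hQpos _), sub_mul, hC, div_mul_cancel₀ _ (hQpos _).ne', hQ]
    linarith [he k]
  refine summable_of_sum_range_le (c := C 0 - B) (fun k => div_nonneg (hd k) (hQpos _).le)
    fun n => ?_
  calc ∑ k ∈ Finset.range n, d k / Q (k + 1)
      ≤ ∑ k ∈ Finset.range n, (C k - C (k + 1)) := Finset.sum_le_sum fun k _ => hstep k
    _ = C 0 - C n := Finset.sum_range_sub' C n
    _ ≤ C 0 - B := by
      linarith [hB ⟨n, rfl⟩, energy_le_reference hη hQ0 hQ hC0 hC hd he n]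

/-- Weighted summability with at most linearly growing weights forces small terms infinitely
often. -/
lemma frequently_lt_of_summable_div_weight (hQpos : ∀ k, 0 < Q k) (hQ : ∀ k, Q k ≤ k + 1)
    (hs : Summable fun k => d k / Q (k + 1)) {ε : ℝ} (hε : 0 < ε) : ∃ᶠ k in atTop, d k < ε := by
  intro h
  have hle : ∀ᶠ k : ℕ in atTop, ‖1 / ((k : ℝ) + 2)‖ ≤ ε⁻¹ * (d k / Q (k + 1)) := by
    filter_upwards [h] with k hk
    have hk : ε ≤ d k := not_lt.1 hk
    have hQk := hQ (k + 1)
    push_cast at hQk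
    rw [Real.norm_of_nonneg (by positivity), ← mul_div_assoc]
    refine div_le_div₀ (mul_nonneg (inv_nonneg.2 hε.le) (hε.le.trans hk)) ?_ (hQpos _)
      (by linarith)
    rw [inv_mul_eq_div, one_le_div hε]
    exact hk
  have hsum : Summable fun k : ℕ => 1 / ((k : ℝ) + 2) :=
    (hs.mul_left ε⁻¹).of_norm_bounded_eventually_nat hle
  refine Real.not_summable_one_div_natCast ((summable_nat_add_iff 2).1 ?_)
  simpa using hsum

end

/-- Theorem 3.6 (a),(b): for the normalized ZH-type nonmonotone LMM,
`∑ α_k ‖g_k‖²/Q_{k+1} < ∞`, and if `w_k = p(v_k)` converges then its limit is a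
critical point of `E` not belonging to `L`. -/
theorem statement13
    {X : Type*} [NormedAddCommGroup X] [InnerProductSpace ℝ X] [CompleteSpace X]
    (E : X → ℝ) (hE : ContDiff ℝ 1 E)
    (L : Submodule ℝ X) [FiniteDimensional ℝ L]
    (v0perp v0L : X) (hv0perp : v0perp ∈ Lᗮ) (hv0perp0 : v0perp ≠ 0) (hv0L : v0L ∈ L)
    (hv0norm : ‖v0perp + v0L‖ = 1)
    (p : X → X)
    (hpsel : ∀ u : X, ‖u‖ = 1 →
      p u ∈ halfspaceCone L u ∧ IsLocalMaxOn E (halfspaceCone L u) (p u))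
    (t : X → ℝ) (wL : X → X)
    (hdecomp : ∀ u : X, ‖u‖ = 1 → p u = t u • u + wL u ∧ 0 ≤ t u ∧ wL u ∈ L)
    (σ ρ : ℝ) (hσ : σ ∈ Set.Ioo (0 : ℝ) 1) (hρ : ρ ∈ Set.Ioo (0 : ℝ) 1)
    (lmin lmax : ℝ) (hlmin : 0 < lmin) (hlle : lmin ≤ lmax)
    (ηmin ηmax : ℝ) (hηmin : 0 ≤ ηmin) (hηlt : ηmin < ηmax) (hηmax : ηmax ≤ 1)
    (lam η : ℕ → ℝ) (m : ℕ → ℕ) (α : ℕ → ℝ)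
    (hlam : ∀ k, lam k ∈ Set.Icc lmin lmax)
    (hη : ∀ k, η k ∈ Set.Icc ηmin ηmax)
    (v : ℕ → X) (Q C : ℕ → ℝ)
    (hv00 : v 0 = v0perp + v0L)
    (hQ0 : Q 0 = 1) (hC0 : C 0 = E (p (v 0)))
    (hαdef : ∀ k, α k = lam k * ρ ^ m k)
    (hZH : ∀ k : ℕ,
      E (p (stepv (v k) (gradient E (p (v k))) (α k))) ≤
        C k - σ * α k * t (v k) * ‖gradient E (p (v k))‖ ^ 2)
    (hmmin : ∀ k : ℕ, ∀ m' < m k,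
      ¬ (E (p (stepv (v k) (gradient E (p (v k))) (lam k * ρ ^ m'))) ≤
        C k - σ * (lam k * ρ ^ m') * t (v k) * ‖gradient E (p (v k))‖ ^ 2))
    (hrecv : ∀ k, v (k + 1) = stepv (v k) (gradient E (p (v k))) (α k))
    (hrecQ : ∀ k, Q (k + 1) = η k * Q k + 1)
    (hrecC : ∀ k, C (k + 1) = (η k * Q k * C k + E (p (v (k + 1)))) / Q (k + 1))
    (hV0 : ∀ k, v k ∈ V0 L v0L)
    (hpc : ContinuousOn p (V0 L v0L))
    (δ : ℝ) (hδ : 0 < δ) (ht : ∀ k, δ ≤ t (v k))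
    (hbdd : BddBelow (Set.range fun k => E (p (v k)))) :
    Summable (fun k => α k * ‖gradient E (p (v k))‖ ^ 2 / Q (k + 1)) ∧
    ∀ ubar : X, Tendsto (fun k => p (v k)) atTop (nhds ubar) →
      ubar ∉ L ∧ fderiv ℝ E ubar = 0 := by
  have hp : IsPeakSelection E L p t wL := ⟨fun u hu => (hpsel u hu).2, hdecomp⟩
  have hv0L1 : ‖v0L‖ < 1 := by
    have h := norm_add_sq_eq_norm_sq_add_norm_sq_real
      (show ⟪v0perp, v0L⟫ = 0 from (Submodule.mem_orthogonal' L _).1 hv0perp _ hv0L)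
    rw [hv0norm] at h
    have := norm_pos_iff.2 hv0perp0
    nlinarith [norm_nonneg v0L]
  have htc := hp.continuousOn_coeff hv0L hv0L1 hpc
  have hη0 : ∀ k, 0 ≤ η k := fun k => hηmin.trans (hη k).1
  have hQ1 := one_le_weight hη0 hQ0 hrecQ
  have hQpos : ∀ k, 0 < Q k := fun k => zero_lt_one.trans_le (hQ1 k)
  have hα : ∀ k, 0 < α k := fun k => by
    rw [hαdef]
    exact mul_pos (hlmin.trans_le (hlam k).1) (pow_pos hρ.1 _)
  have hd0 : ∀ k, 0 ≤ σ * α k * t (v k) * ‖gradient E (p (v k))‖ ^ 2 := fun k =>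
    mul_nonneg (mul_nonneg (mul_nonneg hσ.1.le (hα k).le) (hδ.le.trans (ht k))) (sq_nonneg _)
  have hdec : ∀ k, E (p (v (k + 1))) ≤
      C k - σ * α k * t (v k) * ‖gradient E (p (v k))‖ ^ 2 := fun k => by
    rw [hrecv]
    exact hZH k
  have hEC := energy_le_reference (e := fun k => E (p (v k))) hη0 hQ0 hrecQ hC0 hrecC hd0 hdec
  have hsum : Summable (fun k => α k * ‖gradient E (p (v k))‖ ^ 2 / Q (k + 1)) := by
    have hs := summable_decrease_div_weight (e := fun k => E (p (v k))) hη0 hQ0 hrecQ hC0 hrecC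
      hd0 hdec hbdd
    refine (hs.mul_left (σ * δ)⁻¹).of_nonneg_of_le
      (fun k => div_nonneg (mul_nonneg (hα k).le (sq_nonneg _)) (hQpos _).le) fun k => ?_
    rw [← mul_div_assoc]
    refine div_le_div_of_nonneg_right ?_ (hQpos _).le
    rw [inv_mul_eq_div, le_div_iff₀ (mul_pos hσ.1 hδ)]
    have : 0 ≤ σ * α k * ‖gradient E (p (v k))‖ ^ 2 :=
      mul_nonneg (mul_nonneg hσ.1.le (hα k).le) (sq_nonneg _)
    nlinarith [ht k]
  refine ⟨hsum, fun ubar hubar => ?_⟩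
  -- the limit of any subsequence of `v` is a preimage of `ubar` with coefficient at least `δ`
  have hlimit : ∀ (θ : ℕ → ℕ), StrictMono θ → ∀ u ∈ V0 L v0L, Tendsto (v ∘ θ) atTop (𝓝 u) →
      p u = ubar ∧ δ ≤ t u := by
    intro θ hθ u hu hlim
    have hw : Tendsto (v ∘ θ) atTop (𝓝[V0 L v0L] u) :=
      tendsto_nhdsWithin_iff.2 ⟨hlim, Eventually.of_forall fun _ => hV0 _⟩
    exact ⟨tendsto_nhds_unique ((hpc u hu).tendsto.comp hw) (hubar.comp hθ.tendsto_atTop),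
      ge_of_tendsto' ((htc u hu).tendsto.comp hw) fun _ => ht _⟩
  constructor
  · obtain ⟨u, hu, θ, hθ, hlim⟩ := hp.exists_tendsto_subseq hv0L hv0L1 hV0 hδ ht hubar
    obtain ⟨hpu, htu⟩ := hlimit θ hθ u hu hlim
    intro hmem
    have h := hp.starProjection_eq hu.1
    rw [hpu, (Submodule.starProjection_apply_eq_zero_iff _).2
      (Submodule.le_orthogonal_orthogonal L hmem)] at h
    exact smul_ne_zero (hδ.trans_le htu).ne'
      (starProjection_orthogonal_ne_zero_of_mem_V0 hv0L1 hu hv0L) h.symm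
  · by_contra hcrit
    have hg0 : gradient E ubar ≠ 0 := by
      rwa [gradient, Ne, LinearIsometryEquiv.map_eq_zero_iff]
    have hgc : Continuous (gradient E) :=
      (InnerProductSpace.toDual ℝ X).symm.continuous.comp (hE.continuous_fderiv one_ne_zero)
    have hglim : Tendsto (fun k => ‖gradient E (p (v k))‖) atTop (𝓝 ‖gradient E ubar‖) :=
      ((hgc.tendsto ubar).comp hubar).norm
    set G := ‖gradient E ubar‖ with hG
    have hGpos : 0 < G := norm_pos_iff.2 hg0
    have hfreq : ∀ n : ℕ, ∃ᶠ k in atTop, α k < 1 / ((n : ℝ) + 1) := fun n => by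
      have h := frequently_lt_of_summable_div_weight hQpos
        (weight_le hη0 (fun k => (hη k).2.trans hηmax) hQ0 hrecQ) hsum
        (ε := 1 / ((n : ℝ) + 1) * (G / 2) ^ 2) (by positivity)
      refine (h.and_eventually (hglim.eventually (lt_mem_nhds (half_lt_self hGpos)))).mono ?_
      rintro k ⟨h1, h2⟩
      have h3 : (G / 2) ^ 2 ≤ ‖gradient E (p (v k))‖ ^ 2 := by gcongr
      have h4 : 0 < (G / 2) ^ 2 := by positivity
      exact lt_of_mul_lt_mul_right
        ((mul_le_mul_of_nonneg_left h3 (hα k).le).trans_lt h1) h4.le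
    obtain ⟨φ, hφ, hαφ⟩ := extraction_forall_of_frequently hfreq
    have hαlim : Tendsto (fun n => α (φ n)) atTop (𝓝 0) :=
      squeeze_zero (fun n => (hα _).le) (fun n => (hαφ n).le)
        tendsto_one_div_add_atTop_nhds_zero_nat
    obtain ⟨u, hu, ψ, hψ, hlim⟩ := hp.exists_tendsto_subseq hv0L hv0L1 (fun n => hV0 (φ n)) hδ
      (fun n => ht (φ n)) (hubar.comp hφ.tendsto_atTop)
    obtain ⟨hpu, htu⟩ := hlimit (φ ∘ ψ) (hφ.comp hψ) u hu hlim
    obtain ⟨r, hr, hev⟩ := hp.eventually_energy_stepv_le hE hpc htc hu (hδ.trans_le htu)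
      (by rwa [hpu]) hσ.2
    have hw : Tendsto (fun j => v (φ (ψ j))) atTop (𝓝[V0 L v0L] u) :=
      tendsto_nhdsWithin_iff.2 ⟨hlim, Eventually.of_forall fun _ => hV0 _⟩
    have hαψ := hαlim.comp hψ.tendsto_atTop
    obtain ⟨j, hj1, hj2, hj3⟩ := ((hw.eventually hev).and
      ((hαψ.eventually (gt_mem_nhds hlmin)).and
        (hαψ.eventually (gt_mem_nhds (mul_pos hr hρ.1))))).exists
    simp only [Function.comp_apply] at hj2 hj3
    set k := φ (ψ j)
    -- the rejected trial step preceding `α k` contradicts the uniform decrease near `u`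
    have hm : m k ≠ 0 := fun h => by
      rw [hαdef, h, pow_zero, mul_one] at hj2
      exact hj2.not_ge (hlam k).1
    obtain ⟨n, hn⟩ := Nat.exists_eq_succ_of_ne_zero hm
    have hαk : α k = lam k * ρ ^ n * ρ := by rw [hαdef, hn, pow_succ, mul_assoc]
    refine hmmin k n (by omega) ((hj1 (lam k * ρ ^ n) ?_ ?_).trans ?_)
    · exact mul_nonneg (hlmin.le.trans (hlam k).1) (pow_nonneg hρ.1.le _)
    · rw [hαk] at hj3
      exact lt_of_mul_lt_mul_right hj3 hρ.1.le
    · exact sub_le_sub_right (hEC k) _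
end
end
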